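/- Suppose that for each edge (i,j) ∈ E the rule X^B_{ij} is seller-monotone. Then the buyer-run Meta-Auction allocation MA(B) is monotone for the sellers: for any buyer report vector v, any seller j, any reports s_{-j} of the other sellers, and any two costs s'_j < s_j, if seller j trades (with some buyer i) in MA(B) at the profile (v, (s_j, s_{-j})), then seller j also trades (with the same buyer i) in MA(B) at the profile (v, (s'_j, s_{-j})). -/

import Mathlib

open Finset

noncomputable section

/-- The weight of a set of buyer–seller edges `M` under buyer bids `b` and seller bids `s`:
`∑_{(i,j)∈M} (b i − s j)`. -/
def matchWeight {m n : ℕ} (b : Fin m → ℝ) (s : Fin n → ℝ)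
    (M : Finset (Fin m × Fin n)) : ℝ :=
  ∑ e ∈ M, (b e.1 - s e.2)

/-- A set of edges is a matching: no two distinct edges share a buyer or share a seller. -/
def IsMatching {m n : ℕ} (M : Finset (Fin m × Fin n)) : Prop :=
  ∀ e ∈ M, ∀ e' ∈ M, e ≠ e' → e.1 ≠ e'.1 ∧ e.2 ≠ e'.2

/-- A two-sided matching market with `m` buyers and `n` sellers: a finite edge set `E`,
a nonempty downward-closed family `Fam` of matchings contained in `E`, a fixed strict
linear tie-breaking order `tb` on `Fam`, and the selection `Mstar b s` of the `tb`-least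
maximum-weight member of `Fam`. -/
structure MarketSetup (m n : ℕ) where
  E : Finset (Fin m × Fin n)
  Fam : Finset (Finset (Fin m × Fin n))
  tb : Finset (Fin m × Fin n) → Finset (Fin m × Fin n) → Prop
  Mstar : (Fin m → ℝ) → (Fin n → ℝ) → Finset (Fin m × Fin n)
  empty_mem : ∅ ∈ Fam
  subset_E : ∀ M ∈ Fam, M ⊆ E
  matching : ∀ M ∈ Fam, IsMatching M
  downward_closed : ∀ M ∈ Fam, ∀ M' ⊆ M, M' ∈ Fam
  tb_irrefl : ∀ M ∈ Fam, ¬ tb M M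
  tb_trans : ∀ M₁ ∈ Fam, ∀ M₂ ∈ Fam, ∀ M₃ ∈ Fam, tb M₁ M₂ → tb M₂ M₃ → tb M₁ M₃
  tb_total : ∀ M₁ ∈ Fam, ∀ M₂ ∈ Fam, M₁ ≠ M₂ → tb M₁ M₂ ∨ tb M₂ M₁
  Mstar_mem : ∀ b s, Mstar b s ∈ Fam
  Mstar_max : ∀ b s, ∀ M ∈ Fam, matchWeight b s M ≤ matchWeight b s (Mstar b s)
  Mstar_lt : ∀ b s, ∀ M ∈ Fam,
      matchWeight b s M = matchWeight b s (Mstar b s) → M ≠ Mstar b s →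
      tb (Mstar b s) M

/-- The set of costs `c` of seller `j` for which `(i,j)` lies in the maximum-weight
matching `M*(b, (c, s₋ⱼ))`. -/
def critSet {m n : ℕ} (mk : MarketSetup m n) (i : Fin m) (j : Fin n)
    (b : Fin m → ℝ) (s : Fin n → ℝ) : Set ℝ :=
  {c : ℝ | (i, j) ∈ mk.Mstar b (Function.update s j c)}

/-- The critical cost `c̄_ij(b, s₋ⱼ) = sup {c ∈ ℝ : (i,j) ∈ M*(b, (c, s₋ⱼ))}`,
taken in the extended reals, with `sup ∅ = −∞`. -/
def critCost {m n : ℕ} (mk : MarketSetup m n) (i : Fin m) (j : Fin n)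
    (b : Fin m → ℝ) (s : Fin n → ℝ) : EReal :=
  sSup ((fun x : ℝ => (x : EReal)) '' critSet mk i j b s)

/-- A cap-parameterized bilateral-trade allocation rule: `X κ b c = true` iff trade
occurs when the censoring cap is `κ`, the buyer's bid is `b`, and the seller's
reported cost is `c`. -/
def BTRule := EReal → ℝ → ℝ → Bool

/-- Buyer-monotonicity (DSIC-B): if trade occurs at bid `b` it also occurs at any higher bid. -/
def BuyerMonotone (X : BTRule) : Prop :=
  ∀ (κ : EReal) (b b' c : ℝ), b ≤ b' → X κ b c = true → X κ b' c = true

/-- Seller-monotonicity (DSIC-S): if trade occurs at cost `c` it also occurs at any lower cost. -/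
def SellerMonotone (X : BTRule) : Prop :=
  ∀ (κ : EReal) (b c c' : ℝ), c' ≤ c → X κ b c = true → X κ b c' = true

/-- Cap-monotonicity: if trade occurs under cap `κ₁` it also occurs under any larger cap `κ₂`. -/
def CapMonotone (X : BTRule) : Prop :=
  ∀ (κ₁ κ₂ : EReal) (b c : ℝ), κ₁ ≤ κ₂ → X κ₁ b c = true → X κ₂ b c = true

/-- Buyer-run Meta-Auction allocation MA(B): at report profile `(v,s)`, seller `j`
trades with buyer `i` iff `(i,j) ∈ M*(v,s)` and the bilateral rule for the edge
trades under the cap `c̄_ij(v, s₋ⱼ)` with buyer bid `vᵢ` and seller cost `sⱼ`. -/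
def tradesMAB {m n : ℕ} (mk : MarketSetup m n)
    (XB : Fin m × Fin n → BTRule)
    (v : Fin m → ℝ) (s : Fin n → ℝ) (i : Fin m) (j : Fin n) : Prop :=
  (i, j) ∈ mk.Mstar v s ∧
    XB (i, j) (critCost mk i j v s) (v i) (s j) = true

/-- Seller-run Meta-Auction allocation MA(S): at report profile `(b,c)`, buyer `i`
trades with seller `j` iff `(i,j) ∈ M*(b,c)` and the bilateral rule for the edge
trades under the cap `c̄_ij(b, c₋ⱼ)` with buyer bid `bᵢ` and seller cost `cⱼ`. -/
def tradesMAS {m n : ℕ} (mk : MarketSetup m n)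
    (XS : Fin m × Fin n → BTRule)
    (b : Fin m → ℝ) (c : Fin n → ℝ) (i : Fin m) (j : Fin n) : Prop :=
  (i, j) ∈ mk.Mstar b c ∧
    XS (i, j) (critCost mk i j b c) (b i) (c j) = true

/-- Changing the bid of seller `j` to `c` shifts the weight of `M` by `s j - c` for each edge
of `M` at `j`. -/
theorem matchWeight_update {m n : ℕ} (b : Fin m → ℝ) (s : Fin n → ℝ) (j : Fin n) (c : ℝ)
    (M : Finset (Fin m × Fin n)) :
    matchWeight b (Function.update s j c) M =
      matchWeight b s M + #{e ∈ M | e.2 = j} * (s j - c) := by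
  unfold matchWeight
  rw [← nsmul_eq_mul, ← Finset.sum_const, Finset.sum_filter, ← Finset.sum_add_distrib]
  refine Finset.sum_congr rfl fun e _ => ?_
  by_cases h : e.2 = j
  · simp [h]
  · simp [h]

/-- A matching has at most one edge at each seller. -/
theorem IsMatching.card_filter_seller_le_one {m n : ℕ} {M : Finset (Fin m × Fin n)}
    (hM : IsMatching M) (j : Fin n) : #{e ∈ M | e.2 = j} ≤ 1 := by
  refine Finset.card_le_one.2 fun a ha a' ha' => ?_
  rw [Finset.mem_filter] at ha ha'
  by_contra hne
  exact (hM a ha.1 a' ha'.1 hne).2 (ha.2.trans ha'.2.symm)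

/-- The selected matching does not change when a seller who is matched in it lowers her bid. -/
theorem MarketSetup.Mstar_update_eq {m n : ℕ} (mk : MarketSetup m n) (b : Fin m → ℝ)
    (s : Fin n → ℝ) {i : Fin m} {j : Fin n} {c : ℝ} (hc : c ≤ s j)
    (hij : (i, j) ∈ mk.Mstar b s) :
    mk.Mstar b (Function.update s j c) = mk.Mstar b s := by
  have hMF := mk.Mstar_mem b s
  have hNF := mk.Mstar_mem b (Function.update s j c)
  have hNM := mk.Mstar_max b s _ hNF
  have hMN := mk.Mstar_max b (Function.update s j c) _ hMF
  have hM : #{e ∈ mk.Mstar b s | e.2 = j} = 1 :=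
    le_antisymm ((mk.matching _ hMF).card_filter_seller_le_one j)
      (Finset.card_pos.2 ⟨(i, j), by simp [hij]⟩)
  have hN : (#{e ∈ mk.Mstar b (Function.update s j c) | e.2 = j} : ℝ) ≤ 1 := by
    exact_mod_cast (mk.matching _ hNF).card_filter_seller_le_one j
  have hle := mul_le_mul_of_nonneg_right hN (sub_nonneg.2 hc)
  have eM := matchWeight_update b s j c (mk.Mstar b s)
  have eN := matchWeight_update b s j c (mk.Mstar b (Function.update s j c))
  rw [hM, Nat.cast_one] at eM
  by_contra hne
  have h₁ := mk.Mstar_lt b s _ hNF (by linarith) hne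
  have h₂ := mk.Mstar_lt b (Function.update s j c) _ hMF (by linarith) (Ne.symm hne)
  exact mk.tb_irrefl _ hMF (mk.tb_trans _ hMF _ hNF _ hMF h₁ h₂)

/-- The critical cost of an edge at seller `j` does not depend on the bid of `j`. -/
theorem critCost_update {m n : ℕ} (mk : MarketSetup m n) (i : Fin m) (j : Fin n)
    (b : Fin m → ℝ) (s : Fin n → ℝ) (c : ℝ) :
    critCost mk i j b (Function.update s j c) = critCost mk i j b s := by
  simp only [critCost, critSet, Function.update_idem]

/-- If every edge rule `X^B_{ij}` is seller-monotone, then the buyer-run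
Meta-Auction allocation is monotone for the sellers: if seller `j` trades with buyer `i`
at `(v, (sⱼ, s₋ⱼ))` and `s'ⱼ < sⱼ`, then seller `j` trades with the same buyer `i` at
`(v, (s'ⱼ, s₋ⱼ))`. -/
theorem MAB_monotone_for_sellers {m n : ℕ} (mk : MarketSetup m n)
    (XB : Fin m × Fin n → BTRule)
    (hX : ∀ e ∈ mk.E, SellerMonotone (XB e))
    (v : Fin m → ℝ) (s : Fin n → ℝ) (i : Fin m) (j : Fin n)
    (sj' : ℝ) (hs : sj' < s j)
    (htrade : tradesMAB mk XB v s i j) :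
    tradesMAB mk XB v (Function.update s j sj') i j := by
  obtain ⟨hij, hx⟩ := htrade
  refine ⟨(mk.Mstar_update_eq v s hs.le hij).symm ▸ hij, ?_⟩
  rw [critCost_update, Function.update_self]
  exact hX _ (mk.subset_E _ (mk.Mstar_mem v s) hij) _ _ _ _ hs.le hx
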